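/- For every real x ∈ (0,1) and every integer s ≥ 1, the function R_s(x) satisfies the recursion R_s(x) = 1 + g(x)·R_s(x)·(R_{s-1}(x) + R_s(x) + R_{s+1}(x)), where R_0(x) = 0 (as follows from the defining formula, since 1−x^0 = 0). -/

import Mathlib

/-- The map `g(x) = x(1+x+x²)/(1+4x+x²)²`. -/
noncomputable def gfun (x : ℝ) : ℝ := x * (1 + x + x ^ 2) / (1 + 4 * x + x ^ 2) ^ 2

/-- `R_s(x) = ((1+4x+x²)/(1+x+x²)) · ((1−xˢ)(1−x^{s+3}))/((1−x^{s+1})(1−x^{s+2}))`. -/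
noncomputable def Rfun (s : ℕ) (x : ℝ) : ℝ :=
  ((1 + 4 * x + x ^ 2) / (1 + x + x ^ 2)) *
    ((1 - x ^ s) * (1 - x ^ (s + 3))) / ((1 - x ^ (s + 1)) * (1 - x ^ (s + 2)))

/-- For every `x ∈ (0,1)` and integer `s ≥ 1`,
`R_s = 1 + g·R_s·(R_{s−1} + R_s + R_{s+1})` (with `R_0 = 0`). -/
theorem Rfun_recursion (x : ℝ) (hx : x ∈ Set.Ioo (0:ℝ) 1) (s : ℕ) (hs : 1 ≤ s) :
    Rfun s x = 1 + gfun x * Rfun s x * (Rfun (s - 1) x + Rfun s x + Rfun (s + 1) x) := by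
  obtain ⟨h0, h1⟩ := hx
  obtain ⟨t, rfl⟩ : ∃ t, s = t + 1 := ⟨s - 1, by omega⟩
  have key : ∀ n : ℕ, 1 - x ^ (t + (n + 1)) ≠ 0 := fun n =>
    (sub_pos.mpr (pow_lt_one₀ h0.le h1 (by omega))).ne'
  have e1 := key 0
  have e2 := key 1
  have e3 := key 2
  have e4 := key 3
  have p1 : 1 + x + x ^ 2 ≠ 0 := by positivity
  have p2 : 1 + 4 * x + x ^ 2 ≠ 0 := by positivity
  simp only [Rfun, gfun, Nat.add_sub_cancel, add_assoc, Nat.reduceAdd]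
  simp only [Nat.reduceAdd, zero_add] at e1 e2 e3 e4
  simp only [pow_add] at *
  generalize x ^ t = y at *
  clear key
  simp only [← add_assoc, pow_one] at *
  have f1 : 1 - x * y ≠ 0 := by rwa [mul_comm]
  have f2 : 1 - x ^ 2 * y ≠ 0 := by rwa [mul_comm]
  have f3 : 1 - x ^ 3 * y ≠ 0 := by rwa [mul_comm]
  have f4 : 1 - x ^ 4 * y ≠ 0 := by rwa [mul_comm]
  field_simp
  ring
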